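/- arXiv:math/0201016 — 2 statements merged into one kernel-verified Lean document; each statement's English description precedes it below -/
import Mathlib

section
/- Lemma 2. Let ζ₁, ζ₂, … be i.i.d. real random variables with E(ζ₁) = 0 and Λ(λ) := log E(e^{λ ζ₁}) < ∞ for every λ ∈ ℝ. Let C₁ < ∞ and let G : ℝ → [0,∞) be a measurable function with G(x) ≤ C₁ · min(|x|, x²/2) for all x ∈ ℝ. Then there exist constants γ₀ > 0 and C < ∞ such that for every γ with 0 < γ < γ₀ and every integer l with l ≥ 1/γ₀: E exp{ γ l G( (ζ₁ + ⋯ + ζ_l)/l ) } ≤ C. -/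
open MeasureTheory Real ENNReal

/-- Second-order Taylor bound for the exponential, uniform in `|t| ≤ 1`. -/
lemma exp_mul_le_quadratic {t : ℝ} (ht : |t| ≤ 1) (x : ℝ) :
    exp (t * x) ≤ 1 + t * x + t ^ 2 * (2 * (exp (2 * x) + exp (-2 * x))) := by
  have h := Complex.norm_exp_sub_sum_le_norm_mul_exp ((t * x : ℝ) : ℂ) 2
  have e : Complex.exp ((t * x : ℝ) : ℂ)
      - ∑ m ∈ Finset.range 2, ((t * x : ℝ) : ℂ) ^ m / (m.factorial : ℂ)
      = ((exp (t * x) - (1 + t * x) : ℝ) : ℂ) := by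
    simp [Finset.sum_range_succ]
  rw [e, Complex.norm_real, Complex.norm_real, Real.norm_eq_abs, Real.norm_eq_abs, sq_abs] at h
  have h1 := (abs_le.mp h).2
  have h2 : exp |t * x| ≤ exp |x| := by
    rw [exp_le_exp, abs_mul]
    nlinarith [abs_nonneg x]
  have h3 : x ^ 2 ≤ 2 * exp |x| := by
    have := quadratic_le_exp_of_nonneg (abs_nonneg x)
    rw [sq_abs] at this
    linarith [abs_nonneg x]
  have h4 : exp |x| * exp |x| ≤ exp (2 * x) + exp (-2 * x) := by
    rw [← exp_add]
    rcases abs_cases x with ⟨hx, -⟩ | ⟨hx, -⟩ <;> rw [hx]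
    · rw [← two_mul]; linarith [exp_pos (-2 * x)]
    · rw [← two_mul, show 2 * -x = -2 * x by ring]; linarith [exp_pos (2 * x)]
  have h5 : (t * x) ^ 2 * exp |t * x| ≤ t ^ 2 * (2 * (exp (2 * x) + exp (-2 * x))) := by
    rw [mul_pow, mul_assoc]
    refine mul_le_mul_of_nonneg_left ?_ (sq_nonneg t)
    calc x ^ 2 * exp |t * x| ≤ (2 * exp |x|) * exp |x| := by gcongr
      _ ≤ _ := by linarith
  linarith

/-- A centred law with finite exponential moments has a locally sub-Gaussian moment generating
function. -/
lemma exists_integral_exp_mul_le_exp_sq (μ : Measure ℝ) [IsProbabilityMeasure μ]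
    (hmean : ∫ x, x ∂μ = 0) (hint : ∀ t : ℝ, Integrable (fun x => exp (t * x)) μ) :
    ∃ K : ℝ, 0 ≤ K ∧ ∀ t : ℝ, |t| ≤ 1 → ∫ x, exp (t * x) ∂μ ≤ exp (K * t ^ 2) := by
  have hid : Integrable (fun x : ℝ => x) μ := by
    refine ((hint 1).add (hint (-1))).mono' measurable_id.aestronglyMeasurable
      (ae_of_all _ fun x => ?_)
    simp only [Real.norm_eq_abs, Pi.add_apply, one_mul, neg_mul]
    rw [abs_le]
    constructor <;> linarith [add_one_le_exp x, add_one_le_exp (-x), exp_pos x, exp_pos (-x)]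
  have hdom : Integrable (fun x => 2 * (exp (2 * x) + exp (-2 * x))) μ :=
    ((hint 2).add (hint (-2))).const_mul 2
  refine ⟨∫ x, 2 * (exp (2 * x) + exp (-2 * x)) ∂μ,
    integral_nonneg fun x => by positivity, fun t ht => ?_⟩
  have h1 : Integrable (fun x : ℝ => 1 + t * x) μ := (integrable_const 1).add (hid.const_mul t)
  calc ∫ x, exp (t * x) ∂μ
      ≤ ∫ x, (1 + t * x + t ^ 2 * (2 * (exp (2 * x) + exp (-2 * x)))) ∂μ :=
        integral_mono (hint t) (h1.add (hdom.const_mul _)) fun x => exp_mul_le_quadratic ht x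
    _ = (∫ x, 2 * (exp (2 * x) + exp (-2 * x)) ∂μ) * t ^ 2 + 1 := by
        rw [integral_add h1 (hdom.const_mul _), integral_add (integrable_const 1)
          (hid.const_mul t), integral_const_mul, integral_const_mul, hmean]
        simp
        ring
    _ ≤ _ := add_one_le_exp _

/-- The moment generating function of a sum of i.i.d. variables. -/
lemma lintegral_pi_exp_mul_sum (μ : Measure ℝ) [IsProbabilityMeasure μ] (t : ℝ)
    (hint : Integrable (fun x => exp (t * x)) μ) (l : ℕ) :
    ∫⁻ z : Fin l → ℝ, ENNReal.ofReal (exp (t * ∑ i, z i)) ∂(Measure.pi fun _ : Fin l => μ)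
      = ENNReal.ofReal ((∫ x, exp (t * x) ∂μ) ^ l) := by
  have e : (fun z : Fin l → ℝ => exp (t * ∑ i, z i)) = fun z => ∏ i, exp (t * z i) := by
    ext z
    rw [Finset.mul_sum, exp_sum]
  have hi : Integrable (fun z : Fin l → ℝ => exp (t * ∑ i, z i))
      (Measure.pi fun _ : Fin l => μ) := by
    rw [e]
    exact Integrable.fintype_prod (f := fun _ x => exp (t * x)) fun _ => hint
  rw [← ofReal_integral_eq_lintegral_ofReal hi (ae_of_all _ fun z => (exp_pos _).le), e,
    integral_fintype_prod_eq_pow (fun x : ℝ => exp (t * x))]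
  simp

/-- On a window of width `1 / (2 √l)` above a near-optimal `t`, the exponent `l (t y - B t²)` is
bounded below by a multiple of `l * min y (y ^ 2)`. -/
lemma min_sq_le_linear_sub_sq {B y l t : ℝ} (hB : 1 ≤ B) (hy : 0 ≤ y) (hl : 1 ≤ l)
    (ht : t ∈ Set.Icc (min 1 y / (4 * B)) (min 1 y / (4 * B) + 1 / (2 * √l))) :
    l / (8 * B) * min y (y ^ 2) - B / 2 ≤ t * (l * y) - B * l * t ^ 2 := by
  obtain ⟨ht1, ht2⟩ := ht
  set m := min 1 y with hm
  have hm0 : 0 ≤ m := le_min zero_le_one hy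
  have hmy : m ≤ y := min_le_right _ _
  have hmin : min y (y ^ 2) = m * y := by
    rw [hm, min_mul_of_nonneg _ _ hy, one_mul, sq]
  have hB0 : 0 < B := by linarith
  have hl0 : 0 < l := by linarith
  set s := m / (4 * B) with hs
  have hmB : m = 4 * B * s := by rw [hs]; field_simp
  have hs0 : 0 ≤ s := by positivity
  have hd : (t - s) ^ 2 * l ≤ 1 / 4 := by
    calc (t - s) ^ 2 * l ≤ (1 / (2 * √l)) ^ 2 * l := by
          gcongr
          linarith
      _ = 1 / 4 := by
          rw [div_pow, mul_pow, sq_sqrt hl0.le]; field_simp; norm_num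
  have e : l / (8 * B) * (m * y) = l * s * y / 2 := by rw [hmB]; field_simp; ring
  rw [hmin, e]
  have h1 : t ^ 2 * l ≤ 2 * (s ^ 2 * l) + 2 * ((t - s) ^ 2 * l) := by
    nlinarith [mul_nonneg hl0.le (sq_nonneg (s - (t - s)))]
  have h2 : B * (t ^ 2 * l) ≤ B * (2 * (s ^ 2 * l) + 1 / 2) := by gcongr; linarith
  have h3 : s * (l * y) ≤ t * (l * y) := by gcongr
  have h4 : 4 * B * s * (s * l) ≤ y * (s * l) := by
    gcongr
    linarith
  nlinarith

/-- Pointwise domination of the exponential of `l * min |x| (x ^ 2)` by a Gaussian mixture of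
exponentials. -/
lemma exp_min_sq_le_lintegral {B l : ℝ} (hB : 1 ≤ B) (hl : 1 ≤ l) (s : ℝ) :
    ENNReal.ofReal (exp (l / (8 * B) * min |s / l| ((s / l) ^ 2)))
      ≤ ENNReal.ofReal (2 * exp (B / 2)) * ∫⁻ t in Set.Icc (0 : ℝ) 1,
        ENNReal.ofReal (√l * exp (-(B * l * t ^ 2)) * (exp (t * s) + exp (-t * s))) := by
  have hl0 : 0 < l := by linarith
  have hsl : 1 ≤ √l := one_le_sqrt.mpr hl
  set y := |s / l| with hy
  have hys : l * y = |s| := by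
    rw [hy, abs_div, abs_of_pos hl0]; field_simp
  have hy0 : 0 ≤ y := abs_nonneg _
  set a := min 1 y / (4 * B) with ha
  set E := exp (l / (8 * B) * min y (y ^ 2)) with hE
  have ha0 : 0 ≤ a := by have := le_min zero_le_one hy0; positivity
  have ha1 : a ≤ 1 / 2 := by
    rw [ha, div_le_iff₀ (by positivity)]
    linarith [min_le_left 1 y]
  have hw : 1 / (2 * √l) ≤ 1 / 2 := by
    rw [div_le_div_iff₀ (by positivity) (by norm_num)]; linarith
  have hsub : Set.Icc a (a + 1 / (2 * √l)) ⊆ Set.Icc (0 : ℝ) 1 :=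
    Set.Icc_subset_Icc ha0 (by linarith)
  have hlow : ENNReal.ofReal (exp (-(B / 2)) * E / 2) ≤ ∫⁻ t in Set.Icc (0 : ℝ) 1,
      ENNReal.ofReal (√l * exp (-(B * l * t ^ 2)) * (exp (t * s) + exp (-t * s))) := by
    calc ENNReal.ofReal (exp (-(B / 2)) * E / 2)
        = ∫⁻ _ in Set.Icc a (a + 1 / (2 * √l)), ENNReal.ofReal (√l * (exp (-(B / 2)) * E)) := by
          rw [setLIntegral_const, Real.volume_Icc, ← ENNReal.ofReal_mul (by positivity)]
          congr 1
          field_simp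
          ring
      _ ≤ ∫⁻ t in Set.Icc a (a + 1 / (2 * √l)),
          ENNReal.ofReal (√l * exp (-(B * l * t ^ 2)) * (exp (t * s) + exp (-t * s))) := by
          refine setLIntegral_mono' measurableSet_Icc fun t ht => ENNReal.ofReal_le_ofReal ?_
          have h := min_sq_le_linear_sub_sq hB hy0 hl ht
          rw [mul_assoc]
          refine mul_le_mul_of_nonneg_left ?_ (sqrt_nonneg l)
          have hcosh : exp (t * |s|) ≤ exp (t * s) + exp (-t * s) := by
            rcases abs_cases s with ⟨hx, -⟩ | ⟨hx, -⟩ <;> rw [hx]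
            · linarith [exp_pos (-t * s)]
            · rw [show t * -s = -t * s by ring]; linarith [exp_pos (t * s)]
          calc exp (-(B / 2)) * E ≤ exp (-(B * l * t ^ 2)) * exp (t * |s|) := by
                rw [hE, ← exp_add, ← exp_add, exp_le_exp, ← hys]
                linarith
            _ ≤ _ := by gcongr
      _ ≤ _ := lintegral_mono_set hsub
  have hsq : (s / l) ^ 2 = y ^ 2 := (sq_abs _).symm
  rw [hsq]
  calc ENNReal.ofReal E
      = ENNReal.ofReal (2 * exp (B / 2)) * ENNReal.ofReal (exp (-(B / 2)) * E / 2) := by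
        rw [← ENNReal.ofReal_mul (by positivity)]
        congr 1
        have : exp (B / 2) * exp (-(B / 2)) = 1 := by rw [← exp_add]; simp
        linear_combination -E * this
    _ ≤ _ := by gcongr

/-- The scaled Gaussian weight has total mass at most `√π`. -/
lemma setLIntegral_sqrt_mul_exp_neg_sq_le {l : ℝ} (hl : 0 < l) (S : Set ℝ) :
    ∫⁻ t in S, ENNReal.ofReal (2 * (√l * exp (-l * t ^ 2))) ≤ ENNReal.ofReal (2 * √π) := by
  have hi : Integrable (fun t : ℝ => 2 * (√l * exp (-l * t ^ 2))) :=
    ((integrable_exp_neg_mul_sq hl).const_mul _).const_mul _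
  refine (setLIntegral_le_lintegral _ _).trans ?_
  rw [← ofReal_integral_eq_lintegral_ofReal hi (ae_of_all _ fun t => by positivity),
    integral_const_mul, integral_const_mul, integral_gaussian, ← sqrt_mul hl.le,
    mul_div_cancel₀ _ hl.ne']

/-- Lemma 2 (exponential moment bound for block averages). -/
theorem exp_moment_bound_of_block_average
    (μ : Measure ℝ) [IsProbabilityMeasure μ]
    (hmean : ∫ x, x ∂μ = 0)
    (hΛ : ∀ lam : ℝ, ∫⁻ x, ENNReal.ofReal (Real.exp (lam * x)) ∂μ < ⊤)
    (C₁ : ℝ) (G : ℝ → ℝ) (hG_meas : Measurable G)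
    (hG_nonneg : ∀ x, 0 ≤ G x)
    (hG_bound : ∀ x, G x ≤ C₁ * min |x| (x ^ 2 / 2)) :
    ∃ γ₀ : ℝ, 0 < γ₀ ∧ ∃ C : ℝ,
      ∀ γ : ℝ, 0 < γ → γ < γ₀ → ∀ l : ℕ, 1 / γ₀ ≤ (l : ℝ) →
        ∫⁻ z : Fin l → ℝ,
            ENNReal.ofReal (Real.exp (γ * l * G ((∑ i, z i) / l)))
            ∂(Measure.pi fun _ : Fin l => μ)
          ≤ ENNReal.ofReal C := by
  have hint : ∀ t : ℝ, Integrable (fun x => exp (t * x)) μ := fun t =>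
    (lintegral_ofReal_ne_top_iff_integrable (by fun_prop)
      (ae_of_all _ fun x => (exp_pos _).le)).mp (hΛ t).ne
  obtain ⟨K, hK0, hK⟩ := exists_integral_exp_mul_le_exp_sq μ hmean hint
  set B := K + 1 with hBdef
  have hB : 1 ≤ B := by linarith
  refine ⟨1 / (8 * B * (|C₁| + 1)), by positivity, 2 * exp (B / 2) * (2 * √π), ?_⟩
  intro γ hγ hγ' l hl
  have hl0 : 0 < (l : ℝ) := lt_of_lt_of_le (by positivity) hl
  have hl1 : 1 ≤ (l : ℝ) := by exact_mod_cast hl0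
  have hγC : γ * |C₁| ≤ 1 / (8 * B) := by
    rw [lt_div_iff₀ (by positivity)] at hγ'
    rw [le_div_iff₀ (by positivity)]
    nlinarith [mul_pos hγ (by linarith : 0 < B)]
  have hpt : ∀ x : ℝ, γ * l * G x ≤ l / (8 * B) * min |x| (x ^ 2) := fun x => by
    have h0 : 0 ≤ min |x| (x ^ 2) := by positivity
    have h0' : 0 ≤ min |x| (x ^ 2 / 2) := by positivity
    have h1 : min |x| (x ^ 2 / 2) ≤ min |x| (x ^ 2) :=
      min_le_min le_rfl (by linarith [sq_nonneg x])
    have h2 : G x ≤ |C₁| * min |x| (x ^ 2) :=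
      (hG_bound x).trans (mul_le_mul (le_abs_self _) h1 h0' (abs_nonneg _))
    calc γ * l * G x ≤ γ * l * (|C₁| * min |x| (x ^ 2)) := by gcongr
      _ = l * (γ * |C₁|) * min |x| (x ^ 2) := by ring
      _ ≤ l * (1 / (8 * B)) * min |x| (x ^ 2) := by gcongr
      _ = _ := by ring
  set P := Measure.pi fun _ : Fin l => μ with hP
  have hsum : ∀ t ∈ Set.Icc (0 : ℝ) 1,
      ∫⁻ z : Fin l → ℝ, ENNReal.ofReal (√l * exp (-(B * l * t ^ 2)) *
        (exp (t * ∑ i, z i) + exp (-t * ∑ i, z i))) ∂P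
      ≤ ENNReal.ofReal (2 * (√l * exp (-l * t ^ 2))) := fun t ht => by
    have hbound : ∀ r : ℝ, |r| ≤ 1 → (∫ x, exp (r * x) ∂μ) ^ l ≤ exp (l * (K * r ^ 2)) :=
      fun r hr => by
        rw [exp_nat_mul]
        exact pow_le_pow_left₀ (integral_nonneg fun x => (exp_pos _).le) (hK r hr) l
    have ht1 : |t| ≤ 1 := abs_le.mpr ⟨by linarith [ht.1], ht.2⟩
    simp_rw [ENNReal.ofReal_mul (show 0 ≤ √(l : ℝ) * exp (-(B * l * t ^ 2)) by positivity),
      ENNReal.ofReal_add (exp_pos _).le (exp_pos _).le]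
    rw [lintegral_const_mul _ (by fun_prop), lintegral_add_left (by fun_prop),
      lintegral_pi_exp_mul_sum μ t (hint t), lintegral_pi_exp_mul_sum μ (-t) (hint (-t)),
      ← ENNReal.ofReal_add (pow_nonneg (integral_nonneg fun x => (exp_pos _).le) _)
        (pow_nonneg (integral_nonneg fun x => (exp_pos _).le) _),
      ← ENNReal.ofReal_mul (by positivity)]
    refine ENNReal.ofReal_le_ofReal ?_
    have h1 := hbound t ht1
    have h2 := hbound (-t) (by rwa [abs_neg])
    rw [neg_sq] at h2
    calc √(l : ℝ) * exp (-(B * l * t ^ 2)) *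
          ((∫ x, exp (t * x) ∂μ) ^ l + (∫ x, exp (-t * x) ∂μ) ^ l)
        ≤ √(l : ℝ) * exp (-(B * l * t ^ 2)) * (2 * exp (l * (K * t ^ 2))) := by
          gcongr
          linarith
      _ = 2 * (√l * (exp (-(B * l * t ^ 2)) * exp (l * (K * t ^ 2)))) := by ring
      _ = _ := by
          rw [← exp_add, hBdef]
          ring_nf
  calc ∫⁻ z : Fin l → ℝ, ENNReal.ofReal (exp (γ * l * G ((∑ i, z i) / l))) ∂P
      ≤ ∫⁻ z : Fin l → ℝ, ENNReal.ofReal (2 * exp (B / 2)) * (∫⁻ t in Set.Icc (0 : ℝ) 1,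
          ENNReal.ofReal (√l * exp (-(B * l * t ^ 2)) *
            (exp (t * ∑ i, z i) + exp (-t * ∑ i, z i)))) ∂P :=
        lintegral_mono fun z => (ENNReal.ofReal_le_ofReal (exp_le_exp.mpr (hpt _))).trans
          (exp_min_sq_le_lintegral hB hl1 _)
    _ = ENNReal.ofReal (2 * exp (B / 2)) * ∫⁻ t in Set.Icc (0 : ℝ) 1, ∫⁻ z : Fin l → ℝ,
          ENNReal.ofReal (√l * exp (-(B * l * t ^ 2)) *
            (exp (t * ∑ i, z i) + exp (-t * ∑ i, z i))) ∂P := by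
        rw [lintegral_const_mul' _ _ ENNReal.ofReal_ne_top, lintegral_lintegral_swap]
        fun_prop
    _ ≤ ENNReal.ofReal (2 * exp (B / 2)) * ENNReal.ofReal (2 * √π) := by
        gcongr
        exact (setLIntegral_mono' measurableSet_Icc hsum).trans
          (setLIntegral_sqrt_mul_exp_neg_sq_le hl0 _)
    _ = _ := (ENNReal.ofReal_mul (by positivity)).symm
end

section
/- Relative entropy expansion for slowly varying product measures. Let u₁, u₂ : ℝ/ℤ → ℝ be smooth, β > 0, and for N large enough that v₀ + N^{−β} u_i(x) ∈ (z_min, z_max) for all x, define ν^N_i = Π_{j∈T^N} π_{θ(v₀ + N^{−β} u_i(j/N))} for i = 1, 2. Then, writing θ₀′ = θ′(v₀) and F₀″ = F″(θ₀), one has H(ν^N_2 | ν^N_1) = N^{1−2β} θ₀′ ∫_{ℝ/ℤ} ( u₂(x) − u₁(x) ) ( u₂(x) − (F₀″ θ₀′/2)(u₂(x) + u₁(x)) ) dx + O(N^{1−3β}); that is, the difference of the two sides is bounded in absolute value by C N^{1−3β} with C depending only on the model, β, u₁ and u₂. -/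
open Real
open scoped BigOperators Classical

noncomputable section

/-- The single-site spin space `S = [z_min, z_max] ∩ ℤ`. -/
abbrev Spin (zmin zmax : ℤ) := {x : ℤ // x ∈ Finset.Icc zmin zmax}

/-- Log-moment generating function `F` of the single-site measure `p`. -/
def Ffun (zmin zmax : ℤ) (p : ℤ → ℝ) (θ : ℝ) : ℝ :=
  Real.log (∑ z ∈ Finset.Icc zmin zmax, Real.exp (θ * (z : ℝ)) * p z)

/-- Tilted single-site measure `π_θ`. -/
def spiTilt (zmin zmax : ℤ) (p : ℤ → ℝ) (θ : ℝ) (x : ℤ) : ℝ :=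
  p x * Real.exp (θ * (x : ℝ) - Ffun zmin zmax p θ)

/-- Slowly varying product measure with profile `u`. -/
def nuProf (zmin zmax : ℤ) (p : ℤ → ℝ) (θv : ℝ → ℝ) (v₀ β : ℝ) (u : ℝ → ℝ)
    (N : ℕ) [NeZero N] (z : ZMod N → Spin zmin zmax) : ℝ :=
  ∏ j : ZMod N,
    spiTilt zmin zmax p (θv (v₀ + (N : ℝ) ^ (-β) * u ((j.val : ℝ) / (N : ℝ)))) (z j)

/-- Relative entropy of two (probability) measures on a finite set. -/
def relEnt {α : Type*} [Fintype α] (μ ν : α → ℝ) : ℝ :=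
  ∑ z, μ z * Real.log (μ z / ν z)

/-- The average of the translates of `f` by the multiples of `1 / N`. -/
def translateAvg (N : ℕ) (f : ℝ → ℝ) (x : ℝ) : ℝ :=
  (∑ j ∈ Finset.range N, f (x + j / N)) / N

lemma translateAvg_periodic {N : ℕ} (hN : N ≠ 0) {f : ℝ → ℝ} (hf : ∀ x, f (x + 1) = f x) (x : ℝ) :
    translateAvg N f (x + 1 / N) = translateAvg N f x := by
  have hN' : (N : ℝ) ≠ 0 := by exact_mod_cast hN
  unfold translateAvg
  congr 1
  rw [← sub_eq_zero, ← Finset.sum_sub_distrib]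
  have h := Finset.sum_range_sub (fun j : ℕ => f (x + j / N)) N
  have h0 : f (x + (N : ℝ) / N) - f (x + ((0 : ℕ) : ℝ) / N) = 0 := by
    rw [div_self hN', hf]; simp
  rw [h0] at h
  rw [← h]
  refine Finset.sum_congr rfl fun j _ => ?_
  congr 2
  push_cast
  ring

lemma hasDerivAt_translateAvg (N : ℕ) {f : ℝ → ℝ} (hf : Differentiable ℝ f) (x : ℝ) :
    HasDerivAt (translateAvg N f) (translateAvg N (deriv f) x) x := by
  unfold translateAvg
  refine HasDerivAt.div_const (HasDerivAt.fun_sum fun j _ => ?_) _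
  exact (hf _).hasDerivAt.comp_add_const x _

lemma abs_translateAvg_le {N : ℕ} (hN : N ≠ 0) {f : ℝ → ℝ} {M : ℝ} (hf : ∀ x, |f x| ≤ M) (x : ℝ) :
    |translateAvg N f x| ≤ M := by
  have hN' : (0 : ℝ) < N := by exact_mod_cast Nat.pos_of_ne_zero hN
  unfold translateAvg
  rw [abs_div, abs_of_pos hN', div_le_iff₀ hN']
  refine (Finset.abs_sum_le_sum_abs _ _).trans ?_
  refine (Finset.sum_le_card_nsmul _ _ M fun j _ => hf _).trans ?_
  simp [mul_comm]

lemma deriv_periodic {f : ℝ → ℝ} (hf : ∀ x, f (x + 1) = f x) (x : ℝ) :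
    deriv f (x + 1) = deriv f x := by
  rw [← deriv_comp_add_const]
  simp only [hf]

lemma abs_translateAvg_deriv_le {N : ℕ} (hN : N ≠ 0) {M : ℝ} (k : ℕ) :
    ∀ f : ℝ → ℝ, ContDiff ℝ (⊤ : ℕ∞) f → (∀ x, f (x + 1) = f x) →
      (∀ x, |iteratedDeriv (k + 1) f x| ≤ M) →
      ∀ x, |translateAvg N (deriv f) x| ≤ M * (1 / N) ^ k := by
  induction k with
  | zero =>
    intro f _ _ hM x
    simpa using abs_translateAvg_le hN (by simpa using hM) x
  | succ k ih =>
    intro f hf hper hM x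
    have hN' : (0 : ℝ) < N := by exact_mod_cast Nat.pos_of_ne_zero hN
    have hf' : ContDiff ℝ (⊤ : ℕ∞) (deriv f) := (contDiff_infty_iff_deriv.1 hf).2
    have hd : Differentiable ℝ f := hf.differentiable (by simp)
    have hd' : Differentiable ℝ (deriv f) := hf'.differentiable (by simp)
    have key := ih (deriv f) hf' (deriv_periodic hper) (by
      intro y; rw [← iteratedDeriv_succ']; exact hM y)
    have hh : (0 : ℝ) < 1 / N := by positivity
    obtain ⟨c, hc, hc0⟩ := exists_deriv_eq_zero (f := translateAvg N f)
      (show x < x + 1 / N by linarith)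
      (fun y _ => (hasDerivAt_translateAvg N hd y).continuousAt.continuousWithinAt)
      (translateAvg_periodic hN hper x).symm
    rw [(hasDerivAt_translateAvg N hd c).deriv] at hc0
    have hb := Convex.norm_image_sub_le_of_norm_hasDerivWithin_le (s := Set.univ) (x := c) (y := x)
      (fun y _ => (hasDerivAt_translateAvg N hd' y).hasDerivWithinAt)
      (fun y _ => key y) convex_univ trivial trivial
    rw [hc0, sub_zero, Real.norm_eq_abs, Real.norm_eq_abs] at hb
    have hxc : |x - c| ≤ 1 / N := by rw [abs_le]; constructor <;> linarith [hc.1, hc.2]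
    refine hb.trans ?_
    rw [pow_succ, ← mul_assoc]
    exact mul_le_mul_of_nonneg_left hxc ((abs_nonneg _).trans (key x))

lemma exists_abs_le_of_periodic {f : ℝ → ℝ} (hf : Continuous f) (hper : ∀ x, f (x + 1) = f x) :
    ∃ M, 0 ≤ M ∧ ∀ x, |f x| ≤ M := by
  obtain ⟨M, hM⟩ := (isCompact_Icc (a := (0 : ℝ)) (b := 1)).exists_bound_of_continuousOn
    hf.continuousOn
  refine ⟨M, (norm_nonneg _).trans (hM 0 (by simp)), fun x => ?_⟩
  obtain ⟨y, hy, hxy⟩ := Function.Periodic.exists_mem_Ico₀ (f := f) hper one_pos x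
  rw [hxy]
  exact hM y ⟨hy.1, hy.2.le⟩

lemma iteratedDeriv_periodic {f : ℝ → ℝ} (hf : ∀ x, f (x + 1) = f x) (k : ℕ) (x : ℝ) :
    iteratedDeriv k f (x + 1) = iteratedDeriv k f x := by
  have h := congrFun (iteratedDeriv_comp_add_const k f 1) x
  simp only [hf] at h
  exact h.symm

lemma integral_translateAvg {N : ℕ} (hN : N ≠ 0) {f : ℝ → ℝ} (hf : Continuous f)
    (hper : ∀ x, f (x + 1) = f x) :
    ∫ x in (0 : ℝ)..1, translateAvg N f x = ∫ x in (0 : ℝ)..1, f x := by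
  have hN' : (N : ℝ) ≠ 0 := by exact_mod_cast hN
  unfold translateAvg
  rw [intervalIntegral.integral_div, intervalIntegral.integral_finsetSum]
  · have h : ∀ j ∈ Finset.range N, ∫ x in (0 : ℝ)..1, f (x + (j : ℝ) / N) =
        ∫ x in (0 : ℝ)..1, f x := by
      intro j _
      rw [intervalIntegral.integral_comp_add_right, add_comm 1, zero_add]
      simpa using Function.Periodic.intervalIntegral_add_eq (f := f) (T := 1) hper ((j : ℝ) / N) 0
    rw [Finset.sum_congr rfl h]
    simp
    field_simp
  · intro j _
    exact (hf.comp (continuous_id.add continuous_const)).intervalIntegrable _ _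

/-- Riemann sums of smooth periodic functions converge faster than any power of the mesh. -/
lemma exists_riemann_sum_error_le {f : ℝ → ℝ} (hf : ContDiff ℝ (⊤ : ℕ∞) f)
    (hper : ∀ x, f (x + 1) = f x) (k : ℕ) :
    ∃ M, 0 ≤ M ∧ ∀ N : ℕ, N ≠ 0 →
      |(∑ j ∈ Finset.range N, f (j / N)) / N - ∫ x in (0 : ℝ)..1, f x| ≤ M * (1 / N) ^ k := by
  obtain ⟨M, hM0, hM⟩ := exists_abs_le_of_periodic
    (hf.continuous_iteratedDeriv (k + 1) (by exact_mod_cast le_top))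
    (iteratedDeriv_periodic hper (k + 1))
  refine ⟨M, hM0, fun N hN => ?_⟩
  have hd : Differentiable ℝ f := hf.differentiable (by simp)
  have key := abs_translateAvg_deriv_le hN k f hf hper hM
  have hcont : Continuous (translateAvg N f) :=
    continuous_iff_continuousAt.2 fun y => (hasDerivAt_translateAvg N hd y).continuousAt
  have h0 : (∑ j ∈ Finset.range N, f (j / N)) / N = translateAvg N f 0 := by
    simp [translateAvg]
  have h1 : translateAvg N f 0 - ∫ x in (0 : ℝ)..1, f x =
      ∫ x in (0 : ℝ)..1, (translateAvg N f 0 - translateAvg N f x) := by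
    rw [intervalIntegral.integral_sub (by simp) (hcont.intervalIntegrable _ _),
      integral_translateAvg hN hf.continuous hper]
    simp
  rw [h0, h1]
  have hb := intervalIntegral.norm_integral_le_of_norm_le_const (a := 0) (b := 1)
    (f := fun x => translateAvg N f 0 - translateAvg N f x) (C := M * (1 / N) ^ k) (by
      intro x hx
      rw [Set.uIoc_of_le zero_le_one] at hx
      have := Convex.norm_image_sub_le_of_norm_hasDerivWithin_le (s := Set.univ) (x := x) (y := 0)
        (fun y _ => (hasDerivAt_translateAvg N hd y).hasDerivWithinAt)
        (fun y _ => key y) convex_univ trivial trivial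
      refine this.trans (mul_le_of_le_one_right (by positivity) ?_)
      rw [Real.norm_eq_abs, abs_le]
      constructor <;> linarith [hx.1, hx.2])
  simpa using hb

lemma sum_prod_mul_apply {ι κ : Type*} [Fintype ι] [DecidableEq ι] [Fintype κ]
    (m : ι → κ → ℝ) (hm : ∀ i, ∑ x, m i x = 1) (i : ι) (g : κ → ℝ) :
    ∑ z : ι → κ, (∏ j, m j (z j)) * g (z i) = ∑ x, m i x * g x := by
  have h : ∀ z : ι → κ, (∏ j, m j (z j)) * g (z i) =
      ∏ j, (m j (z j) * if j = i then g (z j) else 1) := by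
    intro z
    rw [Finset.prod_mul_distrib]
    simp
  simp_rw [h]
  rw [← Fintype.piFinset_univ,
    ← Finset.prod_univ_sum (fun _ => Finset.univ) fun j x => m j x * if j = i then g x else 1,
    Finset.prod_eq_single i]
  · simp
  · intro j _ hj
    simp [hj, hm]
  · simp

/-- Relative entropy tensorizes over product measures. -/
lemma relEnt_prod {ι κ : Type*} [Fintype ι] [DecidableEq ι] [Fintype κ]
    (m n : ι → κ → ℝ) (hm : ∀ i x, 0 < m i x) (hn : ∀ i x, 0 < n i x)
    (hm1 : ∀ i, ∑ x, m i x = 1) :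
    relEnt (fun z : ι → κ => ∏ j, m j (z j)) (fun z => ∏ j, n j (z j)) =
      ∑ i, relEnt (m i) (n i) := by
  unfold relEnt
  simp_rw [← Finset.prod_div_distrib]
  have h : ∀ z : ι → κ, (∏ j, m j (z j)) * Real.log (∏ j, m j (z j) / n j (z j)) =
      ∑ i, (∏ j, m j (z j)) * Real.log (m i (z i) / n i (z i)) := by
    intro z
    rw [Real.log_prod fun j _ => (div_pos (hm j _) (hn j _)).ne', Finset.mul_sum]
  simp_rw [h]
  rw [Finset.sum_comm]
  exact Finset.sum_congr rfl fun i _ =>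
    sum_prod_mul_apply m hm1 i fun x => Real.log (m i x / n i x)

/-- The unnormalized `k`-th moment of the tilted single-site measure. -/
def tiltMoment (zmin zmax : ℤ) (p : ℤ → ℝ) (k : ℕ) (θ : ℝ) : ℝ :=
  ∑ z ∈ Finset.Icc zmin zmax, (z : ℝ) ^ k * (Real.exp (θ * (z : ℝ)) * p z)

lemma hasDerivAt_tiltMoment (zmin zmax : ℤ) (p : ℤ → ℝ) (k : ℕ) (θ : ℝ) :
    HasDerivAt (tiltMoment zmin zmax p k) (tiltMoment zmin zmax p (k + 1) θ) θ := by
  unfold tiltMoment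
  refine HasDerivAt.fun_sum fun z _ => ?_
  have h := ((((hasDerivAt_id θ).mul_const (z : ℝ)).exp).mul_const (p z)).const_mul ((z : ℝ) ^ k)
  exact h.congr_deriv (by simp only [id]; ring)

lemma contDiff_tiltMoment (zmin zmax : ℤ) (p : ℤ → ℝ) (k : ℕ) :
    ContDiff ℝ (⊤ : ℕ∞) (tiltMoment zmin zmax p k) := by
  unfold tiltMoment
  fun_prop

lemma tiltMoment_zero_pos {zmin zmax : ℤ} (hzz : zmin < zmax) {p : ℤ → ℝ}
    (hp : ∀ x ∈ Finset.Icc zmin zmax, 0 < p x) (θ : ℝ) : 0 < tiltMoment zmin zmax p 0 θ := by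
  unfold tiltMoment
  refine Finset.sum_pos (fun z hz => ?_) ⟨zmin, by simp [hzz.le]⟩
  have := hp z hz
  positivity

lemma Ffun_eq (zmin zmax : ℤ) (p : ℤ → ℝ) :
    Ffun zmin zmax p = fun θ => Real.log (tiltMoment zmin zmax p 0 θ) := by
  ext θ
  simp [Ffun, tiltMoment]

lemma hasDerivAt_Ffun {zmin zmax : ℤ} (hzz : zmin < zmax) {p : ℤ → ℝ}
    (hp : ∀ x ∈ Finset.Icc zmin zmax, 0 < p x) (θ : ℝ) :
    HasDerivAt (Ffun zmin zmax p)
      (tiltMoment zmin zmax p 1 θ / tiltMoment zmin zmax p 0 θ) θ := by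
  rw [Ffun_eq]
  exact (hasDerivAt_tiltMoment zmin zmax p 0 θ).log (tiltMoment_zero_pos hzz hp θ).ne'

lemma deriv_Ffun {zmin zmax : ℤ} (hzz : zmin < zmax) {p : ℤ → ℝ}
    (hp : ∀ x ∈ Finset.Icc zmin zmax, 0 < p x) :
    deriv (Ffun zmin zmax p) =
      fun θ => tiltMoment zmin zmax p 1 θ / tiltMoment zmin zmax p 0 θ :=
  funext fun θ => (hasDerivAt_Ffun hzz hp θ).deriv

lemma contDiff_deriv_Ffun {zmin zmax : ℤ} (hzz : zmin < zmax) {p : ℤ → ℝ}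
    (hp : ∀ x ∈ Finset.Icc zmin zmax, 0 < p x) :
    ContDiff ℝ (⊤ : ℕ∞) (deriv (Ffun zmin zmax p)) := by
  rw [deriv_Ffun hzz hp]
  exact (contDiff_tiltMoment zmin zmax p 1).div (contDiff_tiltMoment zmin zmax p 0)
    fun θ => (tiltMoment_zero_pos hzz hp θ).ne'

lemma deriv_deriv_Ffun_pos {zmin zmax : ℤ} (hzz : zmin < zmax) {p : ℤ → ℝ}
    (hp : ∀ x ∈ Finset.Icc zmin zmax, 0 < p x) (θ : ℝ) :
    0 < deriv (deriv (Ffun zmin zmax p)) θ := by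
  have h0 := tiltMoment_zero_pos hzz hp θ
  rw [deriv_Ffun hzz hp, ((hasDerivAt_tiltMoment zmin zmax p 1 θ).fun_div
    (hasDerivAt_tiltMoment zmin zmax p 0 θ) h0.ne').deriv]
  refine div_pos ?_ (by positivity)
  set m := tiltMoment zmin zmax p 1 θ / tiltMoment zmin zmax p 0 θ with hm
  have hm' : tiltMoment zmin zmax p 1 θ = m * tiltMoment zmin zmax p 0 θ := by
    rw [hm]; field_simp
  have hw : ∀ z ∈ Finset.Icc zmin zmax, 0 < Real.exp (θ * (z : ℝ)) * p z := fun z hz =>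
    mul_pos (Real.exp_pos _) (hp z hz)
  have hvar : 0 < ∑ z ∈ Finset.Icc zmin zmax,
      ((z : ℝ) - m) ^ 2 * (Real.exp (θ * (z : ℝ)) * p z) := by
    have hmem₁ : zmin ∈ Finset.Icc zmin zmax := by simp [hzz.le]
    have hmem₂ : zmax ∈ Finset.Icc zmin zmax := by simp [hzz.le]
    refine Finset.sum_pos' (fun z hz => mul_nonneg (sq_nonneg _) (hw z hz).le) ?_
    by_cases h : (zmin : ℝ) = m
    · refine ⟨zmax, hmem₂, mul_pos ?_ (hw _ hmem₂)⟩
      have : (zmin : ℝ) < zmax := by exact_mod_cast hzz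
      exact pow_pos (by linarith) 2
    · exact ⟨zmin, hmem₁, mul_pos (by have := sub_ne_zero.2 h; positivity) (hw _ hmem₁)⟩
  have hexp : ∑ z ∈ Finset.Icc zmin zmax, ((z : ℝ) - m) ^ 2 * (Real.exp (θ * (z : ℝ)) * p z) =
      tiltMoment zmin zmax p 2 θ - 2 * m * tiltMoment zmin zmax p 1 θ
        + m ^ 2 * tiltMoment zmin zmax p 0 θ := by
    simp only [tiltMoment, Finset.mul_sum, ← Finset.sum_sub_distrib, ← Finset.sum_add_distrib]
    exact Finset.sum_congr rfl fun z _ => by ring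
  rw [hexp, hm'] at hvar
  rw [hm']
  simp only [Nat.reduceAdd]
  nlinarith

lemma deriv_Ffun_injective {zmin zmax : ℤ} (hzz : zmin < zmax) {p : ℤ → ℝ}
    (hp : ∀ x ∈ Finset.Icc zmin zmax, 0 < p x) :
    Function.Injective (deriv (Ffun zmin zmax p)) :=
  (strictMono_of_deriv_pos (deriv_deriv_Ffun_pos hzz hp)).injective

/-- A right inverse near `b` of an injective smooth function with nonzero derivative at the
preimage of `b` is smooth at `b`. -/
lemma contDiffAt_of_rightInverse {g θ : ℝ → ℝ} {b : ℝ} (hg : ContDiff ℝ (⊤ : ℕ∞) g)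
    (hinj : Function.Injective g) (hne : deriv g (θ b) ≠ 0)
    (hθ : ∀ᶠ w in nhds b, g (θ w) = w) : ContDiffAt ℝ (⊤ : ℕ∞) θ b := by
  have hgb : g (θ b) = b := hθ.self_of_nhds
  have hd : HasFDerivAt g
      ((ContinuousLinearEquiv.unitsEquivAut ℝ (Units.mk0 _ hne) : ℝ ≃L[ℝ] ℝ) : ℝ →L[ℝ] ℝ) (θ b) := by
    refine (hg.differentiable (by simp) (θ b)).hasDerivAt.hasFDerivAt.congr_fderiv ?_
    ext
    simp
  have hn : ((⊤ : ℕ∞) : WithTop ℕ∞) ≠ 0 := by simp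
  have h1 := hg.contDiffAt.to_localInverse hd hn
  have h2 := (hg.contDiffAt.hasStrictFDerivAt' hd hn).eventually_right_inverse
  rw [hgb] at h1 h2
  refine h1.congr_of_eventuallyEq ?_
  filter_upwards [h2, hθ] with w hw hw'
  exact hinj (hw'.trans hw.symm)

/-- First-order Taylor expansion with a uniform quadratic remainder. -/
lemma exists_taylor_one_bound {θ : ℝ → ℝ} {b : ℝ} (hθ : ContDiffAt ℝ (⊤ : ℕ∞) θ b) :
    ∃ K δ : ℝ, 0 ≤ K ∧ 0 < δ ∧ ∀ r < δ, ∀ x, |x - b| ≤ r →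
      DifferentiableAt ℝ θ x ∧ |θ x - θ b - deriv θ b * (x - b)| ≤ K * r ^ 2 := by
  have hev : ∀ᶠ x in nhds b, DifferentiableAt ℝ θ x := by
    have := (hθ.of_le (m := 1) (by exact_mod_cast le_top)).eventually (by simp)
    exact this.mono fun x hx => hx.differentiableAt (by simp)
  have hd' : ContDiffAt ℝ 1 (deriv θ) b := by
    have h := (hθ.fderiv_right (m := 1) (by
      rw [one_add_one_eq_two]
      exact WithTop.coe_le_coe.2 (le_top (a := (2 : ℕ∞))))).clm_apply
      (contDiffAt_const (c := (1 : ℝ)))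
    simpa only [fderiv_apply_one_eq_deriv] using h
  obtain ⟨K, t, ht, hK⟩ := hd'.exists_lipschitzOnWith
  obtain ⟨δ, hδ, hball⟩ := Metric.eventually_nhds_iff_ball.1 (hev.and ht)
  refine ⟨K, δ, K.2, hδ, fun r hr x hx => ?_⟩
  have hr0 : 0 ≤ r := (abs_nonneg _).trans hx
  have hmem : ∀ y ∈ Metric.closedBall b r, y ∈ Metric.ball b δ := fun y hy =>
    Metric.closedBall_subset_ball hr hy
  have hxm : x ∈ Metric.closedBall b r := by simpa [Real.dist_eq] using hx
  refine ⟨(hball x (hmem x hxm)).1, ?_⟩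
  have hb := Convex.norm_image_sub_le_of_norm_hasDerivWithin_le (s := Metric.closedBall b r)
    (x := b) (y := x) (C := K * r) (f := fun y => θ y - deriv θ b * (y - b))
    (f' := fun y => deriv θ y - deriv θ b)
    (fun y hy => by
      have h := (hball y (hmem y hy)).1.hasDerivAt.fun_sub
        (((hasDerivAt_id y).sub_const b).const_mul (deriv θ b))
      simpa using h.hasDerivWithinAt)
    (fun y hy => by
      have h := hK.dist_le_mul y (hball y (hmem y hy)).2 b (hball b (Metric.mem_ball_self hδ)).2
      rw [Real.dist_eq] at h
      exact h.trans (mul_le_mul_of_nonneg_left hy K.2))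
    (convex_closedBall b r) (Metric.mem_closedBall_self hr0) hxm
  simp only [sub_self, mul_zero, sub_zero, Real.norm_eq_abs] at hb
  rw [show θ x - θ b - deriv θ b * (x - b) = θ x - deriv θ b * (x - b) - θ b by ring]
  refine hb.trans ?_
  rw [pow_two, ← mul_assoc]
  exact mul_le_mul_of_nonneg_left hx (mul_nonneg K.2 hr0)

/-- Second-order expansion of the single-site relative entropy. -/
lemma abs_bregman_sub_le {F θ : ℝ → ℝ} {v K r : ℝ}
    (hF : ∀ x, DifferentiableAt ℝ F x)
    (hinv : ∀ x, |x - v| ≤ r → deriv F (θ x) = x)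
    (hθ : ∀ x, |x - v| ≤ r →
      DifferentiableAt ℝ θ x ∧ |θ x - θ v - deriv θ v * (x - v)| ≤ K * r ^ 2)
    {s t : ℝ} (hs : |s| ≤ r) (ht : |t| ≤ r) :
    |(θ (v + s) - θ (v + t)) * (v + s) - F (θ (v + s)) + F (θ (v + t))
        - deriv θ v / 2 * (s - t) ^ 2| ≤ 4 * K * r ^ 3 := by
  have hr0 : 0 ≤ r := (abs_nonneg _).trans hs
  have hKr : 0 ≤ K * r ^ 2 := (abs_nonneg _).trans (hθ v (by simpa using hr0)).2
  have hmem : ∀ y, |y| ≤ r → v + y ∈ Metric.closedBall v r := fun y hy => by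
    simpa [Real.dist_eq] using hy
  have hb := Convex.norm_image_sub_le_of_norm_hasDerivWithin_le (s := Metric.closedBall v r)
    (x := v + t) (y := v + s) (C := K * r ^ 2)
    (f := fun x => x * θ x - F (θ x) - θ v * x - deriv θ v / 2 * (x - v) ^ 2)
    (f' := fun x => θ x - θ v - deriv θ v * (x - v))
    (fun x hx => by
      rw [Metric.mem_closedBall, Real.dist_eq] at hx
      have h1 := (hθ x hx).1.hasDerivAt
      have h2 := (hF (θ x)).hasDerivAt.comp x h1
      rw [hinv x hx] at h2
      have h := ((((hasDerivAt_id' x).fun_mul h1).fun_sub h2).fun_sub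
        ((hasDerivAt_id' x).const_mul (θ v))).fun_sub
        ((((hasDerivAt_id' x).sub_const v).fun_pow 2).const_mul (deriv θ v / 2))
      exact (h.congr_deriv (by push_cast; ring)).hasDerivWithinAt)
    (fun x hx => by
      rw [Metric.mem_closedBall, Real.dist_eq] at hx
      exact (hθ x hx).2)
    (convex_closedBall v r) (hmem t ht) (hmem s hs)
  have hR := (hθ (v + t) (by simpa using ht)).2
  have hst : |s - t| ≤ 2 * r := (abs_sub _ _).trans (by linarith)
  simp only [Real.norm_eq_abs, add_sub_add_left_eq_sub, add_sub_cancel_left] at hb hR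
  have hb' := hb.trans (mul_le_mul_of_nonneg_left hst hKr)
  have hR' : |(θ (v + t) - θ v - deriv θ v * t) * (s - t)| ≤ K * r ^ 2 * (2 * r) := by
    rw [abs_mul]
    exact mul_le_mul hR hst (abs_nonneg _) hKr
  calc _ = _ := congrArg abs (by ring)
    _ ≤ _ := (abs_sub _ _).trans (add_le_add hb' hR')
    _ = _ := by ring

lemma spiTilt_pos {zmin zmax : ℤ} {p : ℤ → ℝ} (hp : ∀ x ∈ Finset.Icc zmin zmax, 0 < p x)
    (θ : ℝ) (x : Spin zmin zmax) : 0 < spiTilt zmin zmax p θ x :=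
  mul_pos (hp x x.2) (Real.exp_pos _)

lemma sum_pow_mul_spiTilt {zmin zmax : ℤ} (hzz : zmin < zmax) {p : ℤ → ℝ}
    (hp : ∀ x ∈ Finset.Icc zmin zmax, 0 < p x) (k : ℕ) (θ : ℝ) :
    ∑ x : Spin zmin zmax, ((x : ℤ) : ℝ) ^ k * spiTilt zmin zmax p θ x =
      tiltMoment zmin zmax p k θ / tiltMoment zmin zmax p 0 θ := by
  have h0 := tiltMoment_zero_pos hzz hp θ
  rw [← Finset.sum_subtype (Finset.Icc zmin zmax) (fun _ => Iff.rfl)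
    fun x : ℤ => (x : ℝ) ^ k * spiTilt zmin zmax p θ x]
  conv_rhs => rw [tiltMoment, Finset.sum_div]
  refine Finset.sum_congr rfl fun z _ => ?_
  rw [spiTilt, Real.exp_sub, Ffun_eq, Real.exp_log h0]
  ring

lemma sum_spiTilt {zmin zmax : ℤ} (hzz : zmin < zmax) {p : ℤ → ℝ}
    (hp : ∀ x ∈ Finset.Icc zmin zmax, 0 < p x) (θ : ℝ) :
    ∑ x : Spin zmin zmax, spiTilt zmin zmax p θ x = 1 := by
  simpa [(tiltMoment_zero_pos hzz hp θ).ne'] using sum_pow_mul_spiTilt hzz hp 0 θ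

/-- Relative entropy between two tilts of the single-site measure. -/
lemma relEnt_spiTilt {zmin zmax : ℤ} (hzz : zmin < zmax) {p : ℤ → ℝ}
    (hp : ∀ x ∈ Finset.Icc zmin zmax, 0 < p x) (a b : ℝ) :
    relEnt (fun x : Spin zmin zmax => spiTilt zmin zmax p a x)
        (fun x : Spin zmin zmax => spiTilt zmin zmax p b x) =
      (a - b) * deriv (Ffun zmin zmax p) a - Ffun zmin zmax p a + Ffun zmin zmax p b := by
  have hmean := sum_pow_mul_spiTilt hzz hp 1 a
  have hone := sum_spiTilt hzz hp a
  have hlog : ∀ x : Spin zmin zmax,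
      Real.log (spiTilt zmin zmax p a x / spiTilt zmin zmax p b x) =
        (a - b) * ((x : ℤ) : ℝ) - Ffun zmin zmax p a + Ffun zmin zmax p b := by
    intro x
    have hx := (hp x x.2).ne'
    rw [spiTilt, spiTilt, mul_div_mul_left _ _ hx, ← Real.exp_sub, Real.log_exp]
    ring
  unfold relEnt
  simp_rw [hlog]
  rw [deriv_Ffun hzz hp]
  dsimp only
  rw [← hmean]
  trans (a - b) * ∑ x : Spin zmin zmax, ((x : ℤ) : ℝ) ^ 1 * spiTilt zmin zmax p a x
      - Ffun zmin zmax p a * ∑ x : Spin zmin zmax, spiTilt zmin zmax p a x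
      + Ffun zmin zmax p b * ∑ x : Spin zmin zmax, spiTilt zmin zmax p a x
  · simp only [Finset.mul_sum, ← Finset.sum_sub_distrib, ← Finset.sum_add_distrib]
    exact Finset.sum_congr rfl fun x _ => by ring
  · rw [hone, mul_one, mul_one]

lemma sum_zmod_val (N : ℕ) [NeZero N] (f : ℕ → ℝ) :
    ∑ j : ZMod N, f j.val = ∑ j ∈ Finset.range N, f j := by
  obtain ⟨n, rfl⟩ := Nat.exists_eq_succ_of_ne_zero (NeZero.ne N)
  exact Fin.sum_univ_eq_sum_range f (n + 1)

/-- The relative entropy of two slowly varying product measures is a sum over sites. -/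
lemma relEnt_nuProf {zmin zmax : ℤ} (hzz : zmin < zmax) {p : ℤ → ℝ}
    (hp : ∀ x ∈ Finset.Icc zmin zmax, 0 < p x) (θ : ℝ → ℝ) (v β : ℝ) (u₁ u₂ : ℝ → ℝ)
    (N : ℕ) [NeZero N]
    (hθ : ∀ x, deriv (Ffun zmin zmax p) (θ (v + (N : ℝ) ^ (-β) * u₂ x)) =
      v + (N : ℝ) ^ (-β) * u₂ x) :
    relEnt (nuProf zmin zmax p θ v β u₂ N) (nuProf zmin zmax p θ v β u₁ N) =
      ∑ j ∈ Finset.range N,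
        ((θ (v + (N : ℝ) ^ (-β) * u₂ (j / N)) - θ (v + (N : ℝ) ^ (-β) * u₁ (j / N))) *
            (v + (N : ℝ) ^ (-β) * u₂ (j / N))
          - Ffun zmin zmax p (θ (v + (N : ℝ) ^ (-β) * u₂ (j / N)))
          + Ffun zmin zmax p (θ (v + (N : ℝ) ^ (-β) * u₁ (j / N)))) := by
  rw [← sum_zmod_val N fun j : ℕ =>
        ((θ (v + (N : ℝ) ^ (-β) * u₂ (j / N)) - θ (v + (N : ℝ) ^ (-β) * u₁ (j / N))) *
            (v + (N : ℝ) ^ (-β) * u₂ (j / N))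
          - Ffun zmin zmax p (θ (v + (N : ℝ) ^ (-β) * u₂ (j / N)))
          + Ffun zmin zmax p (θ (v + (N : ℝ) ^ (-β) * u₁ (j / N))))]
  refine (relEnt_prod
    (fun (j : ZMod N) (x : Spin zmin zmax) =>
      spiTilt zmin zmax p (θ (v + (N : ℝ) ^ (-β) * u₂ ((j.val : ℝ) / N))) x)
    (fun (j : ZMod N) (x : Spin zmin zmax) =>
      spiTilt zmin zmax p (θ (v + (N : ℝ) ^ (-β) * u₁ ((j.val : ℝ) / N))) x)
    (fun _ => spiTilt_pos hp _) (fun _ => spiTilt_pos hp _)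
    (fun _ => sum_spiTilt hzz hp _)).trans ?_
  refine Finset.sum_congr rfl fun j _ => ?_
  rw [relEnt_spiTilt hzz hp, hθ]

lemma exists_const_of_eventually {e g : ℕ → ℝ} (hg : ∀ N, N ≠ 0 → 0 < g N) {C : ℝ}
    (h : ∀ᶠ N in Filter.atTop, N ≠ 0 → e N ≤ C * g N) :
    ∃ C', ∀ N, N ≠ 0 → e N ≤ C' * g N := by
  obtain ⟨N₀, hN₀⟩ := Filter.eventually_atTop.1 h
  refine ⟨|C| + ∑ N ∈ Finset.range N₀, |e N / g N|, fun N hN => ?_⟩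
  have hgN := hg N hN
  have hsum : 0 ≤ ∑ N ∈ Finset.range N₀, |e N / g N| :=
    Finset.sum_nonneg fun _ _ => abs_nonneg _
  rcases le_or_gt N₀ N with hle | hlt
  · refine (hN₀ N hle hN).trans (mul_le_mul_of_nonneg_right ?_ hgN.le)
    linarith [le_abs_self C]
  · rw [← div_le_iff₀ hgN]
    have := Finset.single_le_sum (f := fun N => |e N / g N|) (fun _ _ => abs_nonneg _)
      (Finset.mem_range.2 hlt)
    linarith [le_abs_self (e N / g N), abs_nonneg C]

lemma rpow_scaling {N : ℕ} (hN : N ≠ 0) (β : ℝ) :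
    (N : ℝ) ^ ((1 : ℝ) - 2 * β) = N * ((N : ℝ) ^ (-β)) ^ 2 ∧
      (N : ℝ) ^ ((1 : ℝ) - 3 * β) = N * ((N : ℝ) ^ (-β)) ^ 3 := by
  have hN' : (0 : ℝ) < N := by exact_mod_cast Nat.pos_of_ne_zero hN
  constructor
  · rw [← Real.rpow_natCast, ← Real.rpow_mul hN'.le, sub_eq_add_neg, Real.rpow_add hN',
      Real.rpow_one]
    congr 2
    push_cast
    ring
  · rw [← Real.rpow_natCast, ← Real.rpow_mul hN'.le, sub_eq_add_neg, Real.rpow_add hN',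
      Real.rpow_one]
    congr 2
    push_cast
    ring

lemma one_div_pow_le_rpow_neg {N : ℕ} (hN : N ≠ 0) (β : ℝ) :
    (1 / (N : ℝ)) ^ ⌈β⌉₊ ≤ (N : ℝ) ^ (-β) := by
  have hN' : (1 : ℝ) ≤ N := by exact_mod_cast Nat.one_le_iff_ne_zero.2 hN
  rw [one_div, inv_pow, ← Real.rpow_natCast, ← Real.rpow_neg (by positivity)]
  exact Real.rpow_le_rpow_of_exponent_le hN' (neg_le_neg (Nat.le_ceil β))

/-- Relative entropy expansion for slowly varying product measures. -/
theorem relative_entropy_expansion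
    (zmin zmax : ℤ) (hzz : zmin < zmax) (hzmin : zmin ≤ 0) (hzmax : 0 ≤ zmax)
    (p : ℤ → ℝ) (hp_pos : ∀ x ∈ Finset.Icc zmin zmax, 0 < p x)
    (hp_sum : ∑ x ∈ Finset.Icc zmin zmax, p x = 1)
    (θv : ℝ → ℝ)
    (hθv : ∀ w ∈ Set.Ioo (zmin : ℝ) (zmax : ℝ), deriv (Ffun zmin zmax p) (θv w) = w)
    (v₀ : ℝ) (hv₀ : v₀ ∈ Set.Ioo (zmin : ℝ) (zmax : ℝ))
    (θ₀ : ℝ) (hθ₀ : θ₀ = θv v₀)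
    (β : ℝ) (hβ : 0 < β)
    (u₁ u₂ : ℝ → ℝ)
    (hu₁ : ContDiff ℝ (⊤ : ℕ∞) u₁) (hu₂ : ContDiff ℝ (⊤ : ℕ∞) u₂)
    (hu₁_per : ∀ x : ℝ, u₁ (x + 1) = u₁ x) (hu₂_per : ∀ x : ℝ, u₂ (x + 1) = u₂ x) :
    ∃ C : ℝ,
      ∀ (N : ℕ) [NeZero N],
        (∀ x : ℝ, v₀ + (N : ℝ) ^ (-β) * u₁ x ∈ Set.Ioo (zmin : ℝ) (zmax : ℝ)) →
        (∀ x : ℝ, v₀ + (N : ℝ) ^ (-β) * u₂ x ∈ Set.Ioo (zmin : ℝ) (zmax : ℝ)) →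
        |relEnt (nuProf zmin zmax p θv v₀ β u₂ N) (nuProf zmin zmax p θv v₀ β u₁ N)
            - (N : ℝ) ^ ((1 : ℝ) - 2 * β) * deriv θv v₀ *
              (∫ x in (0 : ℝ)..1,
                (u₂ x - u₁ x) *
                  (u₂ x - deriv (deriv (Ffun zmin zmax p)) θ₀ * deriv θv v₀ / 2 *
                    (u₂ x + u₁ x)))|
          ≤ C * (N : ℝ) ^ ((1 : ℝ) - 3 * β) := by
  subst hθ₀
  have hF : ∀ x, DifferentiableAt ℝ (Ffun zmin zmax p) x := fun x =>
    (hasDerivAt_Ffun hzz hp_pos x).differentiableAt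
  have hIoo := isOpen_Ioo.mem_nhds hv₀
  have hinv : ∀ᶠ w in nhds v₀, deriv (Ffun zmin zmax p) (θv w) = w :=
    Filter.mem_of_superset hIoo hθv
  have hθ := contDiffAt_of_rightInverse (contDiff_deriv_Ffun hzz hp_pos)
    (deriv_Ffun_injective hzz hp_pos) (deriv_deriv_Ffun_pos hzz hp_pos _).ne' hinv
  have hprod : deriv (deriv (Ffun zmin zmax p)) (θv v₀) * deriv θv v₀ = 1 := by
    have h := (((contDiff_deriv_Ffun hzz hp_pos).differentiable (by simp)
      (θv v₀)).hasDerivAt).comp v₀ (hθ.differentiableAt (by simp)).hasDerivAt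
    exact (h.congr_of_eventuallyEq (f₁ := id)
      (hinv.mono fun w hw => hw.symm)).unique (hasDerivAt_id v₀)
  obtain ⟨K, δ₁, hK, hδ₁, hT⟩ := exists_taylor_one_bound hθ
  obtain ⟨δ₂, hδ₂, hball⟩ := Metric.mem_nhds_iff.1 hIoo
  obtain ⟨B₁, hB₁, hu₁B⟩ := exists_abs_le_of_periodic hu₁.continuous hu₁_per
  obtain ⟨B₂, hB₂, hu₂B⟩ := exists_abs_le_of_periodic hu₂.continuous hu₂_per
  set B := max B₁ B₂
  have hB : 0 ≤ B := hB₁.trans (le_max_left _ _)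
  obtain ⟨M, hM, hR⟩ := exists_riemann_sum_error_le
    (f := fun x => (u₂ x - u₁ x) ^ 2 / 2) (((hu₂.sub hu₁).pow 2).div_const 2)
    (fun x => by simp only [hu₁_per, hu₂_per]) ⌈β⌉₊
  have hint : (∫ x in (0 : ℝ)..1, (u₂ x - u₁ x) *
      (u₂ x - deriv (deriv (Ffun zmin zmax p)) (θv v₀) * deriv θv v₀ / 2 * (u₂ x + u₁ x))) =
      ∫ x in (0 : ℝ)..1, (u₂ x - u₁ x) ^ 2 / 2 := by
    rw [hprod]
    congr 1
    ext x
    ring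
  rw [hint]
  set I := ∫ x in (0 : ℝ)..1, (u₂ x - u₁ x) ^ 2 / 2
  have hsmall : ∀ᶠ N : ℕ in Filter.atTop, (N : ℝ) ^ (-β) * B < min δ₁ δ₂ := by
    have h := ((tendsto_rpow_neg_atTop hβ).comp tendsto_natCast_atTop_atTop).mul_const B
    rw [zero_mul] at h
    exact h.eventually_lt_const (lt_min hδ₁ hδ₂)
  have hlarge : ∀ᶠ N : ℕ in Filter.atTop, ∀ _ : NeZero N,
      |relEnt (nuProf zmin zmax p θv v₀ β u₂ N) (nuProf zmin zmax p θv v₀ β u₁ N)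
        - (N : ℝ) ^ ((1 : ℝ) - 2 * β) * deriv θv v₀ * I| ≤
      (4 * K * B ^ 3 + |deriv θv v₀| * M) * (N : ℝ) ^ ((1 : ℝ) - 3 * β) := by
    filter_upwards [hsmall] with N hN hNZ
    have hN0 : N ≠ 0 := hNZ.ne
    have hN' : (0 : ℝ) < N := by exact_mod_cast Nat.pos_of_ne_zero hN0
    obtain ⟨hs2, hs3⟩ := rpow_scaling hN0 β
    have hkey := one_div_pow_le_rpow_neg hN0 β
    have hRN := hR N hN0
    rw [hs2, hs3]
    have hε : 0 < (N : ℝ) ^ (-β) := Real.rpow_pos_of_pos hN' _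
    have hb₁ : ∀ x, |(N : ℝ) ^ (-β) * u₁ x| ≤ (N : ℝ) ^ (-β) * B := fun x => by
      rw [abs_mul, abs_of_pos hε]
      exact mul_le_mul_of_nonneg_left ((hu₁B x).trans (le_max_left _ _)) hε.le
    have hb₂ : ∀ x, |(N : ℝ) ^ (-β) * u₂ x| ≤ (N : ℝ) ^ (-β) * B := fun x => by
      rw [abs_mul, abs_of_pos hε]
      exact mul_le_mul_of_nonneg_left ((hu₂B x).trans (le_max_right _ _)) hε.le
    have hinv' : ∀ x, |x - v₀| ≤ (N : ℝ) ^ (-β) * B →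
        deriv (Ffun zmin zmax p) (θv x) = x := fun x hx =>
      hθv x (hball (by
        rw [Metric.mem_ball, Real.dist_eq]
        exact hx.trans_lt (hN.trans_le (min_le_right _ _))))
    have hT' := hT _ (hN.trans_le (min_le_left _ _))
    rw [relEnt_nuProf hzz hp_pos θv v₀ β u₁ u₂ N fun x =>
      hinv' _ (by simpa only [add_sub_cancel_left] using hb₂ x)]
    generalize (N : ℝ) ^ (-β) = ε at *
    have hsite : ∀ j ∈ Finset.range N, _ := fun j _ =>
      abs_bregman_sub_le hF hinv' hT' (hb₂ ((j : ℝ) / N)) (hb₁ ((j : ℝ) / N))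
    have hsum := (Finset.abs_sum_le_sum_abs _ _).trans (Finset.sum_le_card_nsmul _ _ _ hsite)
    rw [Finset.sum_sub_distrib, Finset.card_range, nsmul_eq_mul] at hsum
    have hquad : ∑ j ∈ Finset.range N,
        deriv θv v₀ / 2 * (ε * u₂ ((j : ℝ) / N) - ε * u₁ ((j : ℝ) / N)) ^ 2 =
        N * ε ^ 2 * deriv θv v₀ *
          ((∑ j ∈ Finset.range N, (u₂ ((j : ℝ) / N) - u₁ ((j : ℝ) / N)) ^ 2 / 2) / N) := by
      rw [mul_div_assoc', eq_div_iff hN'.ne', Finset.sum_mul, Finset.mul_sum]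
      exact Finset.sum_congr rfl fun j _ => by ring
    rw [hquad] at hsum
    have hR' := mul_le_mul_of_nonneg_left
      (hRN.trans (mul_le_mul_of_nonneg_left hkey hM)) (abs_nonneg (N * ε ^ 2 * deriv θv v₀))
    rw [← abs_mul, mul_sub, abs_mul (N * ε ^ 2) (deriv θv v₀),
      abs_of_nonneg (show 0 ≤ N * ε ^ 2 by positivity)] at hR'
    calc _ ≤ _ := abs_sub_le _ _ _
      _ ≤ _ := add_le_add hsum hR'
      _ = _ := by ring
  obtain ⟨C, hC⟩ := exists_const_of_eventually
    (e := fun N => if h : N = 0 then 0 else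
      haveI : NeZero N := ⟨h⟩
      |relEnt (nuProf zmin zmax p θv v₀ β u₂ N) (nuProf zmin zmax p θv v₀ β u₁ N)
        - (N : ℝ) ^ ((1 : ℝ) - 2 * β) * deriv θv v₀ * I|)
    (g := fun N => (N : ℝ) ^ ((1 : ℝ) - 3 * β))
    (fun N hN => Real.rpow_pos_of_pos (by exact_mod_cast Nat.pos_of_ne_zero hN) _)
    (hlarge.mono fun N hN hN0 => by
      simp only [hN0, dite_false]
      exact hN ⟨hN0⟩)
  refine ⟨C, fun N hNZ _ _ => ?_⟩
  have h := hC N hNZ.ne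
  simp only [hNZ.ne, dite_false] at h
  exact h

end
end
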